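/- Let G be a finitely generated virtually free group with finite generating set A, let d ∈ V^A(p,γ,T) be a visual metric on G, and let φ be an endomorphism of G with Gφ ≠ {1}. Then the following are equivalent: (i) φ is uniformly continuous as a map from (G,d) to (G,d); (ii) φ satisfies a Hölder condition with respect to d; (iii) φ is a quasi-isometric embedding of (G,d_A) into itself; (iv) the kernel of φ is finite. -/

import Mathlib

open scoped Classical

section Defs

variable {G : Type*}

/-- Word length of `g` with respect to a generating set `A`: the least `n` such that
`g` is a product of `n` elements of `A ∪ A⁻¹`. -/
noncomputable def wordLength [Group G] (A : Set G) (g : G) : ℕ :=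
  sInf {n : ℕ | ∃ w : List G, w.length = n ∧ (∀ x ∈ w, x ∈ A ∨ x⁻¹ ∈ A) ∧ w.prod = g}

/-- The word metric `d_A(g,h)` (as a real number). -/
noncomputable def wordDist [Group G] (A : Set G) (g h : G) : ℝ :=
  (wordLength A (g⁻¹ * h) : ℝ)

/-- The Gromov product `(x|y)_p` with respect to a distance function `d`. -/
noncomputable def gromov {X : Type*} (d : X → X → ℝ) (p x y : X) : ℝ :=
  (d p x + d p y - d x y) / 2

/-- `G` is `δ`-hyperbolic with respect to the generating set `A`. -/
def IsHyperbolicWith [Group G] (A : Set G) (δ : ℝ) : Prop :=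
  ∀ p g₀ g₁ g₂ : G,
    min (gromov (wordDist A) p g₀ g₁) (gromov (wordDist A) p g₁ g₂) - δ ≤
      gromov (wordDist A) p g₀ g₂

/-- `G` is hyperbolic with respect to the generating set `A`. -/
def IsHyperbolic [Group G] (A : Set G) : Prop :=
  ∃ δ : ℝ, 0 ≤ δ ∧ IsHyperbolicWith A δ

/-- `ρ_{p,γ}(g,h) = e^{-γ (g|h)_p}` (and `0` on the diagonal), with respect to a
distance function `dA`. -/
noncomputable def visualRhoOf {X : Type*} (dA : X → X → ℝ) (p : X) (γ : ℝ) (g h : X) : ℝ :=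
  if g = h then 0 else Real.exp (-γ * gromov dA p g h)

/-- `d` is a metric on `X`. -/
structure IsMetric {X : Type*} (d : X → X → ℝ) : Prop where
  refl : ∀ x, d x x = 0
  eq_of : ∀ x y, d x y = 0 → x = y
  symm : ∀ x y, d x y = d y x
  triangle : ∀ x y z, d x z ≤ d x y + d y z

/-- `d` is a visual metric in `V(p,γ,T)` with respect to the distance function `dA`. -/
def InVisualOf {X : Type*} (dA : X → X → ℝ) (p : X) (γ T : ℝ) (d : X → X → ℝ) : Prop :=
  IsMetric d ∧ ∀ g h : X, g ≠ h →
    visualRhoOf dA p γ g h / T ≤ d g h ∧ d g h ≤ T * visualRhoOf dA p γ g h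

/-- `d ∈ V^A(p,γ,T)`: `d` is a visual metric with respect to the word metric `d_A`. -/
def InVisual [Group G] (A : Set G) (p : G) (γ T : ℝ) (d : G → G → ℝ) : Prop :=
  InVisualOf (wordDist A) p γ T d

/-- `φ : (X,d) → (X,d')` satisfies a Hölder condition of exponent `r`. -/
def HolderCondWith {X : Type*} (d d' : X → X → ℝ) (φ : X → X) (r : ℝ) : Prop :=
  ∃ K : ℝ, 0 < K ∧ ∀ g h : X, d' (φ g) (φ h) ≤ K * d g h ^ r

/-- `φ : (X,d) → (X,d')` satisfies a Hölder condition (of some positive exponent). -/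
def SatisfiesHolder {X : Type*} (d d' : X → X → ℝ) (φ : X → X) : Prop :=
  ∃ r : ℝ, 0 < r ∧ HolderCondWith d d' φ r

/-- `φ : (X,d) → (X,d')` satisfies a Lipschitz condition. -/
def LipschitzCond {X : Type*} (d d' : X → X → ℝ) (φ : X → X) : Prop :=
  ∃ K : ℝ, 0 < K ∧ ∀ g h : X, d' (φ g) (φ h) ≤ K * d g h

/-- `φ : (X,d) → (X,d')` is uniformly continuous. -/
def UnifCont {X : Type*} (d d' : X → X → ℝ) (φ : X → X) : Prop :=
  ∀ ε : ℝ, 0 < ε → ∃ δ : ℝ, 0 < δ ∧ ∀ g h : X, d g h < δ → d' (φ g) (φ h) < ε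

/-- `φ : (X,d) → (X,d')` is a quasi-isometric embedding. -/
def QIEmbedding {X : Type*} (d d' : X → X → ℝ) (φ : X → X) : Prop :=
  ∃ lam K : ℝ, 1 ≤ lam ∧ 0 ≤ K ∧ ∀ g h : X,
    (1 / lam) * d g h - K ≤ d' (φ g) (φ h) ∧ d' (φ g) (φ h) ≤ lam * d g h + K

/-- `H` is a quasiconvex subset of `G` with respect to the generating set `A`:
every geodesic word-metric chain joining two points of `H` stays at bounded
distance from `H`. -/
def IsQuasiconvex [Group G] (A : Set G) (H : Set G) : Prop :=
  ∃ q : ℝ, 0 ≤ q ∧ ∀ h ∈ H, ∀ h' ∈ H, ∀ n : ℕ, ∀ g : ℕ → G,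
    g 0 = h → g n = h' → (n : ℝ) = wordDist A h h' →
    (∀ i < n, wordDist A (g i) (g (i + 1)) = 1) →
    ∀ i ≤ n, ∃ z ∈ H, wordDist A (g i) z ≤ q

end Defs

section FreeGroupTree

/-- The length of the longest common prefix of two lists. -/
def commonPrefixLength {α : Type*} [DecidableEq α] : List α → List α → ℕ
  | a :: u, b :: v => if a = b then commonPrefixLength u v + 1 else 0
  | _, _ => 0

lemma min_commonPrefixLength_le {α : Type*} [DecidableEq α] (u v w : List α) :
    min (commonPrefixLength u v) (commonPrefixLength v w) ≤ commonPrefixLength u w := by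
  induction u generalizing v w with
  | nil => simp [commonPrefixLength]
  | cons a u ih =>
    cases v with
    | nil => simp [commonPrefixLength]
    | cons b v =>
      cases w with
      | nil => simp [commonPrefixLength]
      | cons c w =>
        have := ih v w
        simp only [commonPrefixLength]
        grind

variable {B : Type*}

lemma FreeGroup.IsReduced.invRev {u : List (B × Bool)} (hu : FreeGroup.IsReduced u) :
    FreeGroup.IsReduced (FreeGroup.invRev u) := by
  rw [FreeGroup.isReduced_iff_reduce_eq] at hu ⊢
  rw [FreeGroup.reduce_invRev, hu]

lemma norm_mk_inv_mul_mk {u v : List (B × Bool)}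
    (hu : FreeGroup.IsReduced u) (hv : FreeGroup.IsReduced v) :
    ((FreeGroup.mk u)⁻¹ * FreeGroup.mk v).norm + 2 * commonPrefixLength u v =
      u.length + v.length := by
  induction u generalizing v with
  | nil =>
    simp [commonPrefixLength, FreeGroup.norm, ← FreeGroup.one_eq_mk, hv.reduce_eq]
  | cons a u ih =>
    cases v with
    | nil =>
      simp [commonPrefixLength, FreeGroup.norm, ← FreeGroup.one_eq_mk, hu.invRev.reduce_eq]
    | cons b v =>
      by_cases hab : a = b
      · subst hab
        have h := ih (v := v) (hu.infix ⟨[a], [], by simp⟩) (hv.infix ⟨[a], [], by simp⟩)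
        have e : ∀ w, FreeGroup.mk (a :: w) = FreeGroup.mk [a] * FreeGroup.mk w := by
          intro w; simp
        rw [e u, e v, mul_inv_rev, mul_assoc, inv_mul_cancel_left]
        simp only [commonPrefixLength, if_true, List.length_cons]
        omega
      · have hred : FreeGroup.IsReduced (FreeGroup.invRev (a :: u) ++ (b :: v)) := by
          refine List.IsChain.append hu.invRev hv ?_
          intro x hx y hy
          simp [FreeGroup.invRev] at hx hy
          subst hx hy
          intro h1
          by_contra h2
          apply hab
          refine Prod.ext h1 ?_
          revert h2
          cases a.2 <;> cases b.2 <;> simp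
        rw [FreeGroup.inv_mk, FreeGroup.mul_mk]
        simp only [FreeGroup.norm, FreeGroup.toWord_mk, hred.reduce_eq, commonPrefixLength, hab]
        simp

/-- The word metric of a free group with respect to its standard basis. -/
noncomputable def freeDist (x y : FreeGroup B) : ℕ := (x⁻¹ * y).norm

lemma freeDist_self (x : FreeGroup B) : freeDist x x = 0 := by simp [freeDist]

lemma freeDist_comm (x y : FreeGroup B) : freeDist x y = freeDist y x := by
  rw [freeDist, ← FreeGroup.norm_inv_eq]
  simp [freeDist]

lemma freeDist_triangle (x y z : FreeGroup B) :
    freeDist x z ≤ freeDist x y + freeDist y z := by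
  have := FreeGroup.norm_mul_le (x⁻¹ * y) (y⁻¹ * z)
  rwa [mul_assoc, mul_inv_cancel_left] at this

lemma freeDist_add_commonPrefixLength (w x y : FreeGroup B) :
    freeDist x y + 2 * commonPrefixLength (w⁻¹ * x).toWord (w⁻¹ * y).toWord =
      freeDist w x + freeDist w y := by
  have := norm_mk_inv_mul_mk (FreeGroup.isReduced_toWord (x := w⁻¹ * x))
    (FreeGroup.isReduced_toWord (x := w⁻¹ * y))
  rw [FreeGroup.mk_toWord, FreeGroup.mk_toWord] at this
  simpa [freeDist, FreeGroup.norm, mul_assoc] using this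

/-- The four-point condition. -/
lemma freeDist_four_point (x y z w : FreeGroup B) :
    freeDist x z + freeDist w y ≤
      max (freeDist x y + freeDist w z) (freeDist w x + freeDist y z) := by
  have h1 := freeDist_add_commonPrefixLength w x y
  have h2 := freeDist_add_commonPrefixLength w y z
  have h3 := freeDist_add_commonPrefixLength w x z
  have h4 := min_commonPrefixLength_le (w⁻¹ * x).toWord (w⁻¹ * y).toWord (w⁻¹ * z).toWord
  omega

lemma exists_freeDist_geodesic (x y : FreeGroup B) :
    ∃ m : ℕ → FreeGroup B, m 0 = x ∧ m (freeDist x y) = y ∧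
      (∀ i, freeDist (m i) (m (i + 1)) ≤ 1) ∧
      ∀ i ≤ freeDist x y, freeDist x (m i) = i ∧ freeDist (m i) y = freeDist x y - i := by
  set u := (x⁻¹ * y).toWord with hu
  have hy : x * FreeGroup.mk u = y := by rw [hu, FreeGroup.mk_toWord, mul_inv_cancel_left]
  have hlen : freeDist x y = u.length := rfl
  have hstep : ∀ i,
      freeDist (x * FreeGroup.mk (u.take i)) (x * FreeGroup.mk (u.take (i + 1))) ≤ 1 := by
    intro i
    rw [List.take_add_one, ← FreeGroup.mul_mk, freeDist]
    have e : (x * FreeGroup.mk (u.take i))⁻¹ *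
        (x * (FreeGroup.mk (u.take i) * FreeGroup.mk u[i]?.toList)) =
        FreeGroup.mk u[i]?.toList := by group
    rw [e]
    refine FreeGroup.norm_mk_le.trans ?_
    cases u[i]? <;> simp
  refine ⟨fun i => x * FreeGroup.mk (u.take i), by simp [← FreeGroup.one_eq_mk], ?_, hstep, ?_⟩
  · simp [hlen, hy]
  · intro i hi
    have h1 : freeDist x (x * FreeGroup.mk (u.take i)) ≤ i := by
      rw [freeDist, inv_mul_cancel_left]
      exact FreeGroup.norm_mk_le.trans (by simp)
    have h2 : freeDist (x * FreeGroup.mk (u.take i)) y ≤ u.length - i := by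
      have e : y = x * FreeGroup.mk (u.take i) * FreeGroup.mk (u.drop i) := by
        rw [mul_assoc, FreeGroup.mul_mk, List.take_append_drop, hy]
      conv_lhs => rw [e]
      rw [freeDist, inv_mul_cancel_left]
      exact FreeGroup.norm_mk_le.trans (by simp)
    have := freeDist_triangle x (x * FreeGroup.mk (u.take i)) y
    constructor <;> dsimp only <;> omega

/-- Any three points of a free group have a median. -/
lemma exists_freeDist_median (p x y : FreeGroup B) : ∃ m,
    freeDist p m + freeDist m x = freeDist p x ∧
    freeDist p m + freeDist m y = freeDist p y ∧
    freeDist x m + freeDist m y = freeDist x y := by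
  obtain ⟨g, -, -, -, hg⟩ := exists_freeDist_geodesic p x
  have h := freeDist_add_commonPrefixLength p x y
  set k := commonPrefixLength (p⁻¹ * x).toWord (p⁻¹ * y).toWord
  have ht := freeDist_triangle p x y
  have ht' := freeDist_triangle p y x
  rw [freeDist_comm y x] at ht'
  obtain ⟨h1, h2⟩ := hg k (by omega)
  have h4 := freeDist_four_point (g k) p y x
  have h5 := freeDist_triangle p (g k) y
  have h6 := freeDist_triangle x (g k) y
  rw [freeDist_comm (g k) p, freeDist_comm x p, freeDist_comm x (g k)] at h4
  rw [freeDist_comm x (g k)] at h6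
  refine ⟨g k, ?_, ?_, ?_⟩ <;> (try rw [freeDist_comm x (g k)]) <;> omega

/-- A coarse path between two points of a free group passes close to every point of the geodesic
joining them. -/
lemma exists_freeDist_le_of_coarse_path {L n : ℕ} (w : ℕ → FreeGroup B) (m : FreeGroup B)
    (hw : ∀ i < n, freeDist (w i) (w (i + 1)) ≤ L)
    (hm : freeDist (w 0) m + freeDist m (w n) = freeDist (w 0) (w n)) :
    ∃ i ≤ n, freeDist (w i) m ≤ L := by
  by_contra! hcon
  have key : ∀ i ≤ n, freeDist (w 0) (w i) < freeDist (w 0) m + freeDist m (w i) := by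
    intro i
    induction i with
    | zero =>
      intro _
      have := hcon 0 (by omega)
      rw [freeDist_self]
      omega
    | succ i ih =>
      intro hi
      have h1 := ih (by omega)
      have h2 := hw i (by omega)
      have h3 := hcon i (by omega)
      have h4 := freeDist_four_point (w 0) (w i) (w (i + 1)) m
      rw [freeDist_comm m (w 0), freeDist_comm m (w i)] at h4
      rw [freeDist_comm m (w i)] at h1
      omega
  have := key n le_rfl
  omega

lemma finite_of_fg_freeGroup [Group.FG (FreeGroup B)] : Finite B := by
  obtain ⟨S, hS⟩ := Group.fg_def.mp (inferInstance : Group.FG (FreeGroup B))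
  let T : Finset B := S.biUnion fun g => (g.toWord.map Prod.fst).toFinset
  refine Set.finite_univ_iff.mp (T.finite_toSet.subset ?_)
  intro b _
  by_contra hb
  let F : FreeGroup B →* Multiplicative ℤ :=
    FreeGroup.lift fun c => if c = b then Multiplicative.ofAdd 1 else 1
  have hF : F = 1 := by
    refine MonoidHom.eq_of_eqOn_dense hS ?_
    intro g hg
    rw [← FreeGroup.mk_toWord (x := g)]
    simp only [F, FreeGroup.lift_mk, MonoidHom.one_apply]
    apply List.prod_eq_one
    intro x hx
    obtain ⟨c, hc, rfl⟩ := List.mem_map.mp hx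
    have : c.1 ≠ b := by
      rintro rfl
      exact hb (Finset.mem_coe.mpr (Finset.mem_biUnion.mpr
        ⟨g, hg, List.mem_toFinset.mpr (List.mem_map_of_mem hc)⟩))
    simp [this]
  have h := DFunLike.congr_fun hF (FreeGroup.of b)
  simp [F] at h

lemma finite_norm_le [Finite B] (n : ℕ) : {g : FreeGroup B | g.norm ≤ n}.Finite :=
  Set.Finite.preimage FreeGroup.toWord_injective.injOn
    (List.finite_length_le (B × Bool) n)

end FreeGroupTree

section WordLength

variable {G : Type*} [Group G] {A : Set G}

lemma wordLength_le {w : List G} (hw : ∀ x ∈ w, x ∈ A ∨ x⁻¹ ∈ A) :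
    wordLength A w.prod ≤ w.length :=
  Nat.sInf_le ⟨w, rfl, hw, rfl⟩

lemma exists_word_length_eq (hA : Subgroup.closure A = ⊤) (g : G) :
    ∃ w : List G, w.length = wordLength A g ∧ (∀ x ∈ w, x ∈ A ∨ x⁻¹ ∈ A) ∧ w.prod = g := by
  have hg' : g ∈ Submonoid.closure (A ∪ A⁻¹) := by
    rw [← Subgroup.closure_toSubmonoid, hA]
    trivial
  obtain ⟨w, hw, hg⟩ := Submonoid.exists_list_of_mem_closure hg'
  exact Nat.sInf_mem (s := {n : ℕ | ∃ w : List G, w.length = n ∧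
    (∀ x ∈ w, x ∈ A ∨ x⁻¹ ∈ A) ∧ w.prod = g}) ⟨w.length, w, rfl, hw, hg⟩

lemma wordLength_one : wordLength A (1 : G) = 0 := by
  have := wordLength_le (A := A) (w := []) (by simp)
  simpa using this

lemma wordLength_mul_le (hA : Subgroup.closure A = ⊤) (g h : G) :
    wordLength A (g * h) ≤ wordLength A g + wordLength A h := by
  obtain ⟨u, hu, hu', rfl⟩ := exists_word_length_eq hA g
  obtain ⟨v, hv, hv', rfl⟩ := exists_word_length_eq hA h
  rw [← hu, ← hv, ← List.prod_append, ← List.length_append]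
  refine wordLength_le fun x hx => ?_
  rcases List.mem_append.mp hx with hx | hx
  exacts [hu' x hx, hv' x hx]

lemma wordLength_inv_le (hA : Subgroup.closure A = ⊤) (g : G) :
    wordLength A g⁻¹ ≤ wordLength A g := by
  obtain ⟨u, hu, hu', rfl⟩ := exists_word_length_eq hA g
  rw [← hu, List.prod_inv_reverse]
  refine (wordLength_le fun x hx => ?_).trans (by simp)
  simp only [List.mem_reverse, List.mem_map] at hx
  obtain ⟨y, hy, rfl⟩ := hx
  simpa [or_comm] using hu' y hy

lemma wordLength_inv (hA : Subgroup.closure A = ⊤) (g : G) :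
    wordLength A g⁻¹ = wordLength A g :=
  (wordLength_inv_le hA g).antisymm (by simpa using wordLength_inv_le hA g⁻¹)

lemma finite_wordLength_le (hfin : A.Finite) (hA : Subgroup.closure A = ⊤) (n : ℕ) :
    {g : G | wordLength A g ≤ n}.Finite := by
  have hS : {x : G | x ∈ A ∨ x⁻¹ ∈ A}.Finite :=
    hfin.union (hfin.preimage inv_injective.injOn)
  have := hS.to_subtype
  refine ((List.finite_length_le {x : G | x ∈ A ∨ x⁻¹ ∈ A} n).image
    fun w => (w.map Subtype.val).prod).subset ?_
  intro g hg
  obtain ⟨w, hw, hw', rfl⟩ := exists_word_length_eq hA g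
  lift w to List {x : G | x ∈ A ∨ x⁻¹ ∈ A} using hw'
  exact ⟨w, by simpa using hw.trans_le hg, rfl⟩

lemma exists_wordLength_le_of_finite {S : Set G} (hS : S.Finite) :
    ∃ n, ∀ g ∈ S, wordLength A g ≤ n := by
  obtain ⟨n, hn⟩ := (hS.image (wordLength A)).bddAbove
  exact ⟨n, fun g hg => hn ⟨g, hg, rfl⟩⟩

/-- The word metric with values in `ℕ`. -/
noncomputable def wordNatDist (A : Set G) (x y : G) : ℕ := wordLength A (x⁻¹ * y)

lemma wordDist_eq (x y : G) : wordDist A x y = wordNatDist A x y := rfl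

lemma wordNatDist_self (x : G) : wordNatDist A x x = 0 := by
  simp [wordNatDist, wordLength_one]

lemma wordNatDist_comm (hA : Subgroup.closure A = ⊤) (x y : G) :
    wordNatDist A x y = wordNatDist A y x := by
  rw [wordNatDist, ← wordLength_inv hA]
  simp [wordNatDist]

lemma wordNatDist_triangle (hA : Subgroup.closure A = ⊤) (x y z : G) :
    wordNatDist A x z ≤ wordNatDist A x y + wordNatDist A y z := by
  have := wordLength_mul_le hA (x⁻¹ * y) (y⁻¹ * z)
  rwa [mul_assoc, mul_inv_cancel_left] at this

lemma exists_word_path (hA : Subgroup.closure A = ⊤) (x y : G) :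
    ∃ z : ℕ → G, z 0 = x ∧ z (wordNatDist A x y) = y ∧
      (∀ i, wordNatDist A (z i) (z (i + 1)) ≤ 1) ∧
      ∀ i ≤ wordNatDist A x y,
        wordNatDist A x (z i) + wordNatDist A (z i) y = wordNatDist A x y := by
  obtain ⟨w, hw, hw', hxy⟩ := exists_word_length_eq hA (x⁻¹ * y)
  have hy : x * w.prod = y := by rw [hxy, mul_inv_cancel_left]
  have hlen : wordNatDist A x y = w.length := hw.symm
  refine ⟨fun i => x * (w.take i).prod, by simp, by simp [hlen, hy], ?_, ?_⟩
  · intro i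
    simp only [wordNatDist]
    rw [List.take_add_one, List.prod_append]
    have e : (x * (w.take i).prod)⁻¹ * (x * ((w.take i).prod * (w[i]?.toList).prod)) =
        (w[i]?.toList).prod := by group
    rw [e]
    refine (wordLength_le fun a ha => hw' a ?_).trans (by cases w[i]? <;> simp)
    exact List.mem_of_getElem? (Option.mem_toList.mp ha)
  · intro i hi
    have h1 : wordNatDist A x (x * (w.take i).prod) ≤ i := by
      rw [wordNatDist, inv_mul_cancel_left]
      exact (wordLength_le fun a ha => hw' a (List.mem_of_mem_take ha)).trans (by simp)
    have h2 : wordNatDist A (x * (w.take i).prod) y ≤ w.length - i := by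
      have e : y = x * (w.take i).prod * (w.drop i).prod := by
        rw [mul_assoc, List.prod_take_mul_prod_drop, hy]
      conv_lhs => rw [e]
      rw [wordNatDist, inv_mul_cancel_left]
      exact (wordLength_le fun a ha => hw' a (List.mem_of_mem_drop ha)).trans (by simp)
    have := wordNatDist_triangle hA x (x * (w.take i).prod) y
    dsimp only
    omega

end WordLength

section CoarseEmbedding

/-- A map from a group to a free group which is coarsely Lipschitz and metrically proper,
uniformly, with respect to word metrics. -/
structure IsCoarseEmbedding {G B : Type*} [Group G] (A : Set G) (f : G → FreeGroup B) : Prop where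
  lipschitz : ∃ L : ℕ, ∀ x y, wordNatDist A x y ≤ 1 → freeDist (f x) (f y) ≤ L
  proper : ∀ R : ℕ, ∃ C : ℕ, ∀ x y, freeDist (f x) (f y) ≤ R → wordNatDist A x y ≤ C

variable {G B : Type*} [Group G] {A : Set G} {f : G → FreeGroup B}

lemma freeDist_le_mul_wordNatDist (hA : Subgroup.closure A = ⊤) {L : ℕ}
    (hL : ∀ x y, wordNatDist A x y ≤ 1 → freeDist (f x) (f y) ≤ L) (x y : G) :
    freeDist (f x) (f y) ≤ L * wordNatDist A x y := by
  obtain ⟨z, h0, hn, hz, -⟩ := exists_word_path hA x y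
  have key : ∀ i, freeDist (f x) (f (z i)) ≤ L * i := by
    intro i
    induction i with
    | zero => simp [h0, freeDist_self]
    | succ i ih =>
      have := freeDist_triangle (f x) (f (z i)) (f (z (i + 1)))
      have := hL _ _ (hz i)
      rw [mul_add_one]
      omega
  simpa [hn] using key (wordNatDist A x y)

/-- A word geodesic from `x` to `y` is mapped close to any point of the geodesic from `f x` to
`f y`. -/
lemma exists_between_freeDist_le (hA : Subgroup.closure A = ⊤) {L : ℕ}
    (hL : ∀ x y, wordNatDist A x y ≤ 1 → freeDist (f x) (f y) ≤ L) {x y : G} {m : FreeGroup B}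
    (hm : freeDist (f x) m + freeDist m (f y) = freeDist (f x) (f y)) :
    ∃ z, wordNatDist A x z + wordNatDist A z y = wordNatDist A x y ∧ freeDist (f z) m ≤ L := by
  obtain ⟨z, h0, hn, hz, hz'⟩ := exists_word_path hA x y
  obtain ⟨i, hi, h⟩ := exists_freeDist_le_of_coarse_path (n := wordNatDist A x y)
    (fun i => f (z i)) m (fun i _ => hL _ _ (hz i)) (by simpa [h0, hn] using hm)
  exact ⟨z i, hz' i hi, h⟩

/-- A coarse embedding into a free group is a quasi-isometric embedding. -/
lemma IsCoarseEmbedding.exists_wordNatDist_le (hf : IsCoarseEmbedding A f)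
    (hA : Subgroup.closure A = ⊤) :
    ∃ C : ℕ, ∀ x y, wordNatDist A x y ≤ C * freeDist (f x) (f y) + C := by
  obtain ⟨L, hL⟩ := hf.lipschitz
  obtain ⟨C, hC⟩ := hf.proper (2 * L + 1)
  refine ⟨C, fun x y => ?_⟩
  obtain ⟨m, h0, hn, hm, hm'⟩ := exists_freeDist_geodesic (f x) (f y)
  have key : ∀ i ≤ freeDist (f x) (f y), ∀ z, freeDist (f z) (m i) ≤ L →
      wordNatDist A x z ≤ C * i + C := by
    intro i
    induction i with
    | zero =>
      intro _ z hz
      have := hC x z (by rw [freeDist_comm, ← h0]; omega)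
      omega
    | succ i ih =>
      intro hi z hz
      obtain ⟨h1, h2⟩ := hm' i (by omega)
      obtain ⟨t, -, ht⟩ := exists_between_freeDist_le hA hL (x := x) (y := y) (m := m i) (by omega)
      have h3 := ih (by omega) t ht
      have h4 := freeDist_triangle (f t) (m i) (f z)
      have h5 := freeDist_triangle (m i) (m (i + 1)) (f z)
      have h6 := hm i
      rw [freeDist_comm] at hz
      have h7 := hC t z (by omega)
      have := wordNatDist_triangle hA x t z
      rw [mul_add_one]
      omega
  exact key _ le_rfl y (by rw [hn, freeDist_self]; omega)

/-- The Gromov product is bounded above in terms of the median of the images. -/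
lemma IsCoarseEmbedding.exists_gromov_le (hf : IsCoarseEmbedding A f)
    (hA : Subgroup.closure A = ⊤) :
    ∃ C : ℕ, ∀ p x y m, freeDist (f x) m + freeDist m (f y) = freeDist (f x) (f y) →
      gromov (wordDist A) p x y ≤ C * freeDist (f p) m + C := by
  obtain ⟨L, hL⟩ := hf.lipschitz
  obtain ⟨C, hC⟩ := hf.exists_wordNatDist_le hA
  refine ⟨C * L + C, fun p x y m hm => ?_⟩
  obtain ⟨z, hz, hzm⟩ := exists_between_freeDist_le hA hL hm
  have h1 := wordNatDist_triangle hA p z x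
  have h2 := wordNatDist_triangle hA p z y
  rw [wordNatDist_comm hA z x] at h1
  have h3 : wordNatDist A p z ≤ C * (freeDist (f p) m + L) + C := by
    refine (hC p z).trans ?_
    gcongr
    have := freeDist_triangle (f p) m (f z)
    rw [freeDist_comm m] at this
    omega
  have h4 : C * (freeDist (f p) m + L) + C ≤ (C * L + C) * freeDist (f p) m + (C * L + C) := by
    nlinarith [Nat.zero_le (C * L * freeDist (f p) m)]
  have h5 : wordNatDist A p x + wordNatDist A p y ≤
      wordNatDist A x y + 2 * ((C * L + C) * freeDist (f p) m + (C * L + C)) := by omega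
  have h6 : (wordNatDist A p x : ℝ) + wordNatDist A p y ≤
      wordNatDist A x y + 2 * (((C * L + C : ℕ) : ℝ) * freeDist (f p) m + (C * L + C : ℕ)) := by
    exact_mod_cast h5
  simp only [gromov, wordDist_eq]
  linarith

/-- The Gromov product is bounded below in terms of the median of the images. -/
lemma IsCoarseEmbedding.exists_le_gromov (hf : IsCoarseEmbedding A f)
    (hA : Subgroup.closure A = ⊤) :
    ∃ C : ℕ, ∀ p x y m, freeDist (f p) m + freeDist m (f x) = freeDist (f p) (f x) →
      freeDist (f p) m + freeDist m (f y) = freeDist (f p) (f y) →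
      freeDist (f p) m ≤ C * gromov (wordDist A) p x y + C := by
  obtain ⟨L, hL⟩ := hf.lipschitz
  obtain ⟨C, hC⟩ := hf.proper (2 * L)
  refine ⟨L + L * C, fun p x y m hx hy => ?_⟩
  obtain ⟨z, hz, hzm⟩ := exists_between_freeDist_le hA hL hx
  obtain ⟨t, ht, htm⟩ := exists_between_freeDist_le hA hL hy
  have hzt : wordNatDist A z t ≤ C := hC z t (by
    have := freeDist_triangle (f z) m (f t)
    rw [freeDist_comm m] at this
    omega)
  have h1 : freeDist (f p) m ≤ L * wordNatDist A p z + L := by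
    have h := freeDist_triangle (f p) (f z) m
    have h' := freeDist_le_mul_wordNatDist hA hL p z
    omega
  have h2 : freeDist (f p) m ≤ L * wordNatDist A p t + L := by
    have h := freeDist_triangle (f p) (f t) m
    have h' := freeDist_le_mul_wordNatDist hA hL p t
    omega
  have h3 := wordNatDist_triangle hA x z y
  have h4 := wordNatDist_triangle hA z t y
  have h5 := wordNatDist_triangle hA p x y
  rw [wordNatDist_comm hA x z] at h3
  have h6 : wordNatDist A p z + wordNatDist A p t + wordNatDist A x y ≤
      wordNatDist A p x + wordNatDist A p y + C := by omega
  have h7 := wordNatDist_triangle hA x p y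
  rw [wordNatDist_comm hA x p] at h7
  rify at h1 h2 h6 h7
  have hLn : (0 : ℝ) ≤ L := L.cast_nonneg
  have hCn : (0 : ℝ) ≤ C := C.cast_nonneg
  simp only [gromov, wordDist_eq]
  push_cast
  nlinarith [mul_le_mul_of_nonneg_left h6 hLn, mul_le_mul_of_nonneg_left h7 (mul_nonneg hLn hCn),
    mul_nonneg hLn hCn]

end CoarseEmbedding

section VirtuallyFree

universe u

variable {G : Type u} [Group G]

lemma exists_finite_inv_mul_coset_retraction (H : Subgroup G) [H.FiniteIndex] :
    ∃ r : G → H,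
      (∀ S : Set G, S.Finite → ∃ S' : Set H, S'.Finite ∧
        ∀ x y, x⁻¹ * y ∈ S → (r x)⁻¹ * r y ∈ S') ∧
      ∀ S' : Set H, S'.Finite → ∃ S : Set G, S.Finite ∧
        ∀ x y, (r x)⁻¹ * r y ∈ S' → x⁻¹ * y ∈ S := by
  let s : G ⧸ H → G := Quotient.out
  have hs : ∀ g : G, g * s ((g⁻¹ : G) : G ⧸ H) ∈ H := by
    intro g
    have := QuotientGroup.eq.mp (QuotientGroup.out_eq' ((g⁻¹ : G) : G ⧸ H)).symm
    simpa using this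
  have : Finite (G ⧸ H) := inferInstance
  refine ⟨fun g => ⟨g * s ((g⁻¹ : G) : G ⧸ H), hs g⟩, fun S hS => ?_, fun S' hS' => ?_⟩
  · have := hS.to_subtype
    refine ⟨Subtype.val ⁻¹' Set.range fun q : (G ⧸ H) × S × (G ⧸ H) =>
      (s q.1)⁻¹ * q.2.1 * s q.2.2,
      (Set.finite_range _).preimage Subtype.val_injective.injOn, fun x y hxy => ?_⟩
    refine ⟨(((x⁻¹ : G) : G ⧸ H), ⟨_, hxy⟩, ((y⁻¹ : G) : G ⧸ H)), ?_⟩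
    simp [mul_assoc]
  · have := hS'.to_subtype
    refine ⟨Set.range fun q : (G ⧸ H) × S' × (G ⧸ H) => s q.1 * ((q.2.1 : H) : G) * (s q.2.2)⁻¹,
      Set.finite_range _, fun x y hxy => ?_⟩
    refine ⟨(((x⁻¹ : G) : G ⧸ H), ⟨_, hxy⟩, ((y⁻¹ : G) : G ⧸ H)), ?_⟩
    simp [mul_assoc]

lemma MonoidHom.finite_preimage_of_finite_ker {G' : Type*} [Group G'] (φ : G →* G')
    (hφ : {g : G | φ g = 1}.Finite) {S : Set G'} (hS : S.Finite) : (φ ⁻¹' S).Finite := by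
  refine hS.preimage' fun b _ => ?_
  by_cases hb : ∃ x, φ x = b
  · obtain ⟨x, rfl⟩ := hb
    refine (hφ.image (x * ·)).subset fun y hy => ?_
    exact ⟨x⁻¹ * y, by simpa [inv_mul_eq_one] using (Eq.symm hy), by simp⟩
  · convert Set.finite_empty
    ext x
    simpa using fun h => hb ⟨x, h⟩

/-- A finitely generated virtually free group maps to a free group of finite rank in such a way
that precomposing with any homomorphism with finite kernel is a coarse embedding. -/
lemma exists_isCoarseEmbedding_comp (hvf : ∃ H : Subgroup G, IsFreeGroup H ∧ H.FiniteIndex)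
    {A : Set G} (hAfin : A.Finite) (hA : Subgroup.closure A = ⊤) :
    ∃ (B : Type u) (f : G → FreeGroup B), ∀ φ : G →* G, {g : G | φ g = 1}.Finite →
      IsCoarseEmbedding A (f ∘ φ) := by
  obtain ⟨H, hfree, hindex⟩ := hvf
  have : Group.FG G := Group.fg_iff.mpr ⟨A, hA, hAfin⟩
  obtain ⟨B, ⟨b⟩⟩ := hfree.nonempty_basis
  have : Group.FG (FreeGroup B) := Group.fg_of_surjective (f := b.repr.toMonoidHom) b.repr.surjective
  have : Finite B := finite_of_fg_freeGroup
  obtain ⟨r, hr, hr'⟩ := exists_finite_inv_mul_coset_retraction H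
  have hdist : ∀ x y, freeDist (b.repr (r x)) (b.repr (r y)) = (b.repr ((r x)⁻¹ * r y)).norm := by
    intro x y
    simp [freeDist]
  refine ⟨B, fun g => b.repr (r g), fun φ hφ => ⟨?_, fun R => ?_⟩⟩
  · obtain ⟨S', hS', h⟩ := hr _ ((finite_wordLength_le hAfin hA 1).image φ)
    obtain ⟨L, hL⟩ := (hS'.image fun h => (b.repr h).norm).bddAbove
    refine ⟨L, fun x y hxy => ?_⟩
    simp only [Function.comp_apply, hdist]
    exact hL ⟨_, h _ _ ⟨x⁻¹ * y, hxy, by simp⟩, rfl⟩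
  · obtain ⟨S, hS, h⟩ := hr' {g | (b.repr g).norm ≤ R}
      ((finite_norm_le R).preimage b.repr.injective.injOn)
    obtain ⟨C, hC⟩ := exists_wordLength_le_of_finite (A := A)
      (φ.finite_preimage_of_finite_ker hφ hS)
    refine ⟨C, fun x y hxy => hC _ ?_⟩
    simp only [Function.comp_apply, hdist] at hxy
    simpa using h (φ x) (φ y) hxy

end VirtuallyFree

section Endomorphism

variable {G : Type*} [Group G] {A : Set G}

lemma exists_wordNatDist_map_le (hAfin : A.Finite) (hA : Subgroup.closure A = ⊤) (φ : G →* G) :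
    ∃ M : ℕ, ∀ x y, wordNatDist A (φ x) (φ y) ≤ M * wordNatDist A x y := by
  obtain ⟨M, hM⟩ := exists_wordLength_le_of_finite (A := A)
    ((finite_wordLength_le hAfin hA 1).image φ)
  refine ⟨M, fun x y => ?_⟩
  obtain ⟨z, h0, hn, hz, -⟩ := exists_word_path hA x y
  have key : ∀ i, wordNatDist A (φ x) (φ (z i)) ≤ M * i := by
    intro i
    induction i with
    | zero => simp [h0, wordNatDist_self]
    | succ i ih =>
      have h1 := wordNatDist_triangle hA (φ x) (φ (z i)) (φ (z (i + 1)))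
      have h2 : wordNatDist A (φ (z i)) (φ (z (i + 1))) ≤ M := hM _ ⟨_, hz i, by simp⟩
      rw [mul_add_one]
      omega
  simpa [hn] using key (wordNatDist A x y)

lemma qiEmbedding_of_finite_ker (hvf : ∃ H : Subgroup G, IsFreeGroup H ∧ H.FiniteIndex)
    (hAfin : A.Finite) (hA : Subgroup.closure A = ⊤) (φ : G →* G)
    (hφ : {g : G | φ g = 1}.Finite) : QIEmbedding (wordDist A) (wordDist A) φ := by
  obtain ⟨B, f, hf⟩ := exists_isCoarseEmbedding_comp hvf hAfin hA
  obtain ⟨L, hL⟩ := (hf (MonoidHom.id G) (by simp)).lipschitz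
  obtain ⟨C, hC⟩ := (hf φ hφ).exists_wordNatDist_le hA
  obtain ⟨M, hM⟩ := exists_wordNatDist_map_le hAfin hA φ
  set N := C * L + C + M + 1 with hN
  have hN1 : (1 : ℝ) ≤ N := by
    exact_mod_cast (by omega : 1 ≤ N)
  refine ⟨N, N, hN1, by positivity, fun x y => ?_⟩
  have h1 : wordNatDist A x y ≤ C * (L * wordNatDist A (φ x) (φ y)) + C :=
    (hC x y).trans (by gcongr; exact freeDist_le_mul_wordNatDist hA hL (φ x) (φ y))
  have h2 : wordNatDist A x y ≤ N * wordNatDist A (φ x) (φ y) + N := by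
    refine h1.trans ?_
    rw [← mul_assoc]
    gcongr <;> omega
  have h3 : wordNatDist A (φ x) (φ y) ≤ N * wordNatDist A x y + N := by
    refine ((hM x y).trans (by gcongr; omega)).trans (Nat.le_add_right _ N)
  simp only [wordDist_eq]
  refine ⟨?_, by exact_mod_cast h3⟩
  have h4 : (wordNatDist A x y : ℝ) ≤ N * wordNatDist A (φ x) (φ y) + N := by exact_mod_cast h2
  rw [one_div, sub_le_iff_le_add, inv_mul_le_iff₀ (by linarith)]
  nlinarith

lemma exists_gromov_le_gromov_map (hvf : ∃ H : Subgroup G, IsFreeGroup H ∧ H.FiniteIndex)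
    (hAfin : A.Finite) (hA : Subgroup.closure A = ⊤) (φ : G →* G)
    (hφ : {g : G | φ g = 1}.Finite) (p : G) :
    ∃ c C : ℝ, 0 < c ∧ ∀ x y,
      c * gromov (wordDist A) p x y - C ≤ gromov (wordDist A) p (φ x) (φ y) := by
  obtain ⟨B, f, hf⟩ := exists_isCoarseEmbedding_comp hvf hAfin hA
  obtain ⟨K, hK⟩ := (hf φ hφ).exists_gromov_le hA
  obtain ⟨N, hN⟩ := (hf (MonoidHom.id G) (by simp)).exists_le_gromov hA
  have hK0 : (0 : ℝ) ≤ K := K.cast_nonneg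
  have hN0 : (0 : ℝ) ≤ N := N.cast_nonneg
  refine ⟨1 / ((K + 1) * (N + 1)), 2 + wordDist A p (φ p), by positivity, fun x y => ?_⟩
  obtain ⟨m, hx, hy, hxy⟩ := exists_freeDist_median (f (φ p)) (f (φ x)) (f (φ y))
  have h1 := hK p x y m hxy
  have h2 := hN (φ p) (φ x) (φ y) m hx hy
  simp only [Function.comp_apply, MonoidHom.id_apply] at h1 h2
  have h3 : gromov (wordDist A) (φ p) (φ x) (φ y) ≤
      gromov (wordDist A) p (φ x) (φ y) + wordDist A p (φ p) := by
    have hx := wordNatDist_triangle hA (φ p) p (φ x)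
    have hy := wordNatDist_triangle hA (φ p) p (φ y)
    rw [wordNatDist_comm hA (φ p) p] at hx hy
    rify at hx hy
    simp only [gromov, wordDist_eq]
    linarith
  have h4 : 0 ≤ gromov (wordDist A) (φ p) (φ x) (φ y) := by
    have h := wordNatDist_triangle hA (φ x) (φ p) (φ y)
    rw [wordNatDist_comm hA (φ x) (φ p)] at h
    rify at h
    simp only [gromov, wordDist_eq]
    linarith
  set u := gromov (wordDist A) (φ p) (φ x) (φ y)
  set t : ℝ := (freeDist (f (φ p)) m : ℝ)
  have h5 : gromov (wordDist A) p x y ≤ (K + 1) * (N + 1) * (u + 2) := by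
    calc gromov (wordDist A) p x y ≤ K * t + K := h1
      _ ≤ K * (N * u + N) + K := by gcongr
      _ ≤ (K + 1) * (N + 1) * (u + 2) := by
        nlinarith [mul_nonneg hK0 hN0, mul_nonneg hK0 h4, mul_nonneg hN0 h4,
          mul_nonneg (mul_nonneg hK0 hN0) h4]
  have h6 : 1 / ((K + 1) * (N + 1)) * gromov (wordDist A) p x y ≤ u + 2 := by
    rw [one_div, inv_mul_le_iff₀ (by positivity)]
    exact h5
  linarith

variable {p : G} {γ T : ℝ} {d : G → G → ℝ}

lemma IsMetric.nonneg {X : Type*} {d : X → X → ℝ} (hd : IsMetric d) (x y : X) : 0 ≤ d x y := by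
  have := hd.triangle x y x
  rw [hd.refl, hd.symm y x] at this
  linarith

lemma satisfiesHolder_of_gromov_le (hγ : 0 < γ) (hT : 1 ≤ T) (hd : InVisual A p γ T d)
    {φ : G → G} {c C : ℝ} (hc : 0 < c)
    (h : ∀ x y, c * gromov (wordDist A) p x y - C ≤ gromov (wordDist A) p (φ x) (φ y)) :
    SatisfiesHolder d d φ := by
  obtain ⟨hm, hv⟩ := hd
  have hT0 : 0 < T := by linarith
  refine ⟨c, hc, T * Real.exp (γ * C) * T ^ c, by positivity, fun x y => ?_⟩
  by_cases hxy : φ x = φ y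
  · rw [hxy, hm.refl]
    have := hm.nonneg x y
    positivity
  · have hne : x ≠ y := fun h => hxy (h ▸ rfl)
    have h1 := (hv _ _ hxy).2
    have h2 := (hv _ _ hne).1
    rw [visualRhoOf, if_neg hxy] at h1
    rw [visualRhoOf, if_neg hne, div_le_iff₀ hT0] at h2
    have h3 := Real.rpow_le_rpow (Real.exp_nonneg _) h2 hc.le
    rw [← Real.exp_mul, Real.mul_rpow (hm.nonneg x y) hT0.le] at h3
    calc d (φ x) (φ y) ≤ T * Real.exp (-γ * gromov (wordDist A) p (φ x) (φ y)) := h1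
      _ ≤ T * Real.exp (γ * C + -γ * gromov (wordDist A) p x y * c) := by
        gcongr
        nlinarith [mul_le_mul_of_nonneg_left (h x y) hγ.le]
      _ = T * Real.exp (γ * C) * Real.exp (-γ * gromov (wordDist A) p x y * c) := by
        rw [Real.exp_add, ← mul_assoc]
      _ ≤ T * Real.exp (γ * C) * (d x y ^ c * T ^ c) := by gcongr
      _ = T * Real.exp (γ * C) * T ^ c * d x y ^ c := by ring

lemma SatisfiesHolder.unifCont {X : Type*} {d : X → X → ℝ} (hd : IsMetric d) {φ : X → X}
    (h : SatisfiesHolder d d φ) : UnifCont d d φ := by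
  obtain ⟨r, hr, K, hK, h⟩ := h
  intro ε hε
  refine ⟨(ε / K) ^ r⁻¹, by positivity, fun x y hxy => (h x y).trans_lt ?_⟩
  have := Real.rpow_lt_rpow (hd.nonneg x y) hxy hr
  rw [← Real.rpow_mul (by positivity), inv_mul_cancel₀ hr.ne', Real.rpow_one,
    lt_div_iff₀ hK] at this
  linarith

lemma finite_ker_of_unifCont (hAfin : A.Finite) (hA : Subgroup.closure A = ⊤)
    (hγ : 0 < γ) (hT : 1 ≤ T) (hd : InVisual A p γ T d) {φ : G →* G}
    (hnt : ∃ g : G, φ g ≠ 1) (h : UnifCont d d φ) : {g : G | φ g = 1}.Finite := by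
  obtain ⟨hm, hv⟩ := hd
  obtain ⟨g, hg⟩ := hnt
  have hpos : 0 < d 1 (φ g) :=
    (hm.nonneg _ _).lt_of_ne fun h => hg (hm.eq_of _ _ h.symm).symm
  obtain ⟨δ, hδ, h⟩ := h _ hpos
  have hT0 : 0 < T := by linarith
  obtain ⟨n, hn⟩ := exists_nat_gt
    (wordNatDist A p 1 + wordNatDist A 1 g - Real.log (δ / T) / γ : ℝ)
  refine (finite_wordLength_le hAfin hA n).subset fun k hk => ?_
  by_contra hlt
  simp only [Set.mem_ofPred_eq, not_le] at hk hlt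
  have hkg : k ≠ k * g := by
    intro e
    apply hg
    rw [left_eq_mul.mp e, map_one]
  have hdge : ¬ d k (k * g) < δ := fun hlt => by
    have := h _ _ hlt
    simp [hk] at this
  apply hdge
  refine (hv _ _ hkg).2.trans_lt ?_
  rw [visualRhoOf, if_neg hkg, mul_comm, ← lt_div_iff₀ hT0, ← Real.lt_log_iff_exp_lt (by positivity)]
  have hk1 : n < wordNatDist A 1 k := by simpa [wordNatDist] using hlt
  have h1 := wordNatDist_triangle hA 1 p k
  have h2 := wordNatDist_triangle hA p (k * g) k
  have h3 : wordNatDist A k (k * g) = wordNatDist A 1 g := by simp [wordNatDist]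
  rw [wordNatDist_comm hA 1 p] at h1
  rw [wordNatDist_comm hA (k * g) k] at h2
  rify at hk1 h1 h2 h3
  have h4 : -(Real.log (δ / T) / γ) < gromov (wordDist A) p k (k * g) := by
    simp only [gromov, wordDist_eq]
    linarith
  rw [neg_lt, lt_div_iff₀ hγ] at h4
  linarith

lemma QIEmbedding.finite_ker (hAfin : A.Finite) (hA : Subgroup.closure A = ⊤) {φ : G →* G}
    (h : QIEmbedding (wordDist A) (wordDist A) φ) : {g : G | φ g = 1}.Finite := by
  obtain ⟨l, K, hl, hK, h⟩ := h
  obtain ⟨n, hn⟩ := exists_nat_ge (l * K)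
  refine (finite_wordLength_le hAfin hA n).subset fun k hk => ?_
  have h1 := (h 1 k).1
  rw [map_one, show φ k = 1 from hk, wordDist_eq, wordDist_eq, wordNatDist_self, Nat.cast_zero,
    sub_nonpos, one_div, inv_mul_le_iff₀ (by linarith)] at h1
  have h2 : wordNatDist A 1 k ≤ n := by exact_mod_cast h1.trans hn
  simpa [wordNatDist] using h2

end Endomorphism

/-- For a nontrivial endomorphism `φ` of a finitely generated virtually
free group with visual metric `d`, the following are equivalent: uniform continuity,
a Hölder condition, being a quasi-isometric embedding of `(G,d_A)` into itself, and
finiteness of the kernel. -/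
theorem stmt_10 {G : Type*} [Group G]
    (hvf : ∃ H : Subgroup G, IsFreeGroup H ∧ H.FiniteIndex)
    (A : Set G) (hAfin : A.Finite) (hAgen : Subgroup.closure A = ⊤)
    (p : G) (γ T : ℝ) (hγ : 0 < γ) (hT : 1 ≤ T)
    (d : G → G → ℝ) (hd : InVisual A p γ T d)
    (φ : G →* G) (hnt : ∃ g : G, φ g ≠ 1) :
    List.TFAE [UnifCont d d ⇑φ, SatisfiesHolder d d ⇑φ,
      QIEmbedding (wordDist A) (wordDist A) ⇑φ, {g : G | φ g = 1}.Finite] := by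
  tfae_have 2 → 1 := fun h => h.unifCont hd.1
  tfae_have 1 → 4 := finite_ker_of_unifCont hAfin hAgen hγ hT hd hnt
  tfae_have 3 → 4 := fun h => h.finite_ker hAfin hAgen
  tfae_have 4 → 3 := qiEmbedding_of_finite_ker hvf hAfin hAgen φ
  tfae_have 4 → 2 := fun h => by
    obtain ⟨c, C, hc, hC⟩ := exists_gromov_le_gromov_map hvf hAfin hAgen φ h p
    exact satisfiesHolder_of_gromov_le hγ hT hd hc hC
  tfae_finish
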